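/- arXiv:2103.13162 — 2 statements merged into one kernel-verified Lean document; each statement's English description precedes it below -/
import Mathlib

section
/- Let U be a finite distributive lattice with an involutive antitone map star : U → U. For all r, t ∈ U with r ⊓ star(r) = t ⊓ star(t), we have (r ⊔ t) ⊓ star(r ⊔ t) = r ⊓ star(r). In particular, for any subsystem S of U, the equivalence classes of the relation s ~ t defined by s ⊓ star(s) = t ⊓ star(t) are corner-closed subsystems of S. -/
/-- An antitone involution on a lattice turns joins into meets. -/
theorem antitone_involution_sup {U : Type*} [Lattice U] (star : U → U)
    (hinv : ∀ u, star (star u) = u) (hanti : ∀ u v : U, u ≤ v → star v ≤ star u) (r t : U) :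
    star (r ⊔ t) = star r ⊓ star t := by
  refine le_antisymm (le_inf (hanti _ _ le_sup_left) (hanti _ _ le_sup_right)) ?_
  have hr := hanti _ _ (inf_le_left : star r ⊓ star t ≤ star r)
  have ht := hanti _ _ (inf_le_right : star r ⊓ star t ≤ star t)
  rw [hinv] at hr ht
  simpa only [hinv] using hanti _ _ (sup_le hr ht)

/-- In a finite distributive universe of separations, if `r ⊓ star r = t ⊓ star t`
then the join `r ⊔ t` satisfies the same identity; consequently, the classes of
the relation `s ~ t ↔ s ⊓ star s = t ⊓ star t` are corner-closed subsystems of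
any subsystem `S`. -/
theorem join_preserves_small_corner {U : Type*} [DistribLattice U] [Finite U]
    (star : U → U) (hinv : ∀ u, star (star u) = u)
    (hanti : ∀ u v : U, u ≤ v → star v ≤ star u) :
    (∀ r t : U, r ⊓ star r = t ⊓ star t →
      (r ⊔ t) ⊓ star (r ⊔ t) = r ⊓ star r) ∧
    (∀ S : Set U, (∀ s ∈ S, star s ∈ S) → ∀ s₀ ∈ S,
      ∀ r ∈ {t ∈ S | t ⊓ star t = s₀ ⊓ star s₀},
      ∀ t ∈ {t ∈ S | t ⊓ star t = s₀ ⊓ star s₀},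
        r ⊔ t ∈ S → r ⊔ t ∈ {t ∈ S | t ⊓ star t = s₀ ⊓ star s₀}) := by
  have key : ∀ r t : U, r ⊓ star r = t ⊓ star t → (r ⊔ t) ⊓ star (r ⊔ t) = r ⊓ star r := by
    intro r t h
    have hr : r ⊓ star r ≤ star t := h.trans_le inf_le_right
    have ht : t ⊓ star t ≤ star r := h.symm.trans_le inf_le_right
    rw [antitone_involution_sup star hinv hanti, inf_sup_right, ← inf_assoc, inf_eq_left.2 hr,
      inf_comm (star r), ← inf_assoc, inf_eq_left.2 ht, ← h, sup_idem]
  refine ⟨key, ?_⟩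
  rintro S - s₀ - r ⟨-, hr⟩ t ⟨-, ht⟩ hrt
  exact ⟨hrt, (key r t (hr.trans ht.symm)).trans hr⟩
end

section
/- Let U be a finite distributive lattice with an involutive antitone map star : U → U, and let S ⊆ U be closed under star and submodular in U (for all r, s ∈ S, r ⊔ s ∈ S or r ⊓ s ∈ S). Fix s₀ ∈ S and let C = {t ∈ S | t ⊓ star(t) = s₀ ⊓ star(s₀)} (note C is closed under star). Then there exist a finite type V and an injective map ι : C → Set V such that: (i) for all r, t ∈ C, ι(r) ⊆ ι(t) if and only if r ≤ t; (ii) ι(star(t)) = V ∖ ι(t) for all t ∈ C; (iii) whenever r, t ∈ C and r ⊔ t ∈ S then ι(r ⊔ t) = ι(r) ∪ ι(t); and (iv) whenever r, t ∈ C and r ⊓ t ∈ S then ι(r ⊓ t) = ι(r) ∩ ι(t). That is, each such class C admits a corner-faithful embedding into a universe of bipartitions. -/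
/-- In a finite distributive lattice, inequality can be tested on the sup-prime elements. -/
theorem le_of_forall_supPrime_le {U : Type*} [DistribLattice U] [Finite U] {a b : U}
    (h : ∀ p : U, SupPrime p → p ≤ a → p ≤ b) : a ≤ b := by
  have := Fintype.ofFinite U
  have : Nonempty U := ⟨a⟩
  let _ : OrderBot U := Fintype.toOrderBot U
  obtain ⟨s, hs, hirr⟩ := exists_supIrred_decomposition a
  rw [← hs]
  refine Finset.sup_le fun p hp => h p (supPrime_iff_supIrred.2 (hirr hp)) ?_
  rw [← hs]
  exact Finset.le_sup (f := id) hp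

/-- An involutive antitone map of a lattice turns meets into joins. -/
theorem map_inf_of_involutive_antitone {U : Type*} [Lattice U] {star : U → U}
    (hinv : ∀ u, star (star u) = u) (hanti : ∀ u v : U, u ≤ v → star v ≤ star u) (a b : U) :
    star (a ⊓ b) = star a ⊔ star b := by
  refine le_antisymm ?_ (sup_le (hanti _ _ inf_le_left) (hanti _ _ inf_le_right))
  have h : star (star a ⊔ star b) ≤ a ⊓ b :=
    le_inf (by simpa only [hinv] using hanti _ _ (le_sup_left (a := star a) (b := star b)))
      (by simpa only [hinv] using hanti _ _ (le_sup_right (a := star a) (b := star b)))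
  simpa only [hinv] using hanti _ _ h


/-- Each equivalence class `C = {t ∈ S | t ⊓ star t = s₀ ⊓ star s₀}` of a
separation system `S` which is submodular in a finite distributive universe
admits a corner-faithful embedding into a universe of bipartitions. -/
theorem class_embeds_into_bipartition_universe {U : Type*} [DistribLattice U]
    [Finite U] (star : U → U) (hinv : ∀ u, star (star u) = u)
    (hanti : ∀ u v : U, u ≤ v → star v ≤ star u)
    (S : Set U) (hstarS : ∀ s ∈ S, star s ∈ S)
    (hsubmod : ∀ r ∈ S, ∀ s ∈ S, r ⊔ s ∈ S ∨ r ⊓ s ∈ S)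
    (s₀ : U) (hs₀ : s₀ ∈ S) :
    ∃ (V : Type) (_ : Finite V) (ι : U → Set V),
      Set.InjOn ι {t ∈ S | t ⊓ star t = s₀ ⊓ star s₀} ∧
      (∀ r ∈ {t ∈ S | t ⊓ star t = s₀ ⊓ star s₀},
        ∀ t ∈ {t ∈ S | t ⊓ star t = s₀ ⊓ star s₀}, (ι r ⊆ ι t ↔ r ≤ t)) ∧
      (∀ t ∈ {t ∈ S | t ⊓ star t = s₀ ⊓ star s₀}, ι (star t) = (ι t)ᶜ) ∧
      (∀ r ∈ {t ∈ S | t ⊓ star t = s₀ ⊓ star s₀},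
        ∀ t ∈ {t ∈ S | t ⊓ star t = s₀ ⊓ star s₀},
          r ⊔ t ∈ S → ι (r ⊔ t) = ι r ∪ ι t) ∧
      (∀ r ∈ {t ∈ S | t ⊓ star t = s₀ ⊓ star s₀},
        ∀ t ∈ {t ∈ S | t ⊓ star t = s₀ ⊓ star s₀},
          r ⊓ t ∈ S → ι (r ⊓ t) = ι r ∩ ι t) := by
  obtain ⟨n, ⟨e⟩⟩ := Finite.exists_equiv_fin
    {p : U // SupPrime p ∧ p ≤ star (s₀ ⊓ star s₀) ∧ ¬ p ≤ s₀ ⊓ star s₀}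
  have hsup : ∀ t, t ⊓ star t = s₀ ⊓ star s₀ → t ⊔ star t = star (s₀ ⊓ star s₀) := by
    intro t ht
    rw [← ht, map_inf_of_involutive_antitone hinv hanti, hinv, sup_comm]
  have hle : ∀ r ∈ {t ∈ S | t ⊓ star t = s₀ ⊓ star s₀},
      ∀ t ∈ {t ∈ S | t ⊓ star t = s₀ ⊓ star s₀},
      ({i | (e.symm i).1 ≤ r} ⊆ {i | (e.symm i).1 ≤ t} ↔ r ≤ t) := by
    rintro r ⟨-, hr⟩ t ⟨-, ht⟩
    refine ⟨fun h => le_of_forall_supPrime_le fun p hp hpr => ?_, fun h i hi => le_trans hi h⟩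
    by_cases hpc : p ≤ s₀ ⊓ star s₀
    · exact hpc.trans (ht ▸ inf_le_left)
    · have hpV : p ≤ star (s₀ ⊓ star s₀) := hpr.trans (hsup r hr ▸ le_sup_left)
      simpa using @h (e ⟨p, hp, hpV, hpc⟩) (by simpa using hpr)
  refine ⟨Fin n, inferInstance, fun t => {i | (e.symm i).1 ≤ t}, ?_, hle, ?_, ?_, ?_⟩
  · intro r hr t ht h
    exact le_antisymm ((hle r hr t ht).1 h.le) ((hle t ht r hr).1 h.ge)
  · rintro t ⟨-, ht⟩
    ext i
    obtain ⟨hp, hpV, hpc⟩ := (e.symm i).2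
    refine ⟨fun h h' => hpc ((le_inf h' h).trans ht.le), fun h => ?_⟩
    exact (hp.le_sup.1 (hpV.trans (hsup t ht).ge)).resolve_left h
  · intro r _ t _ _
    ext i
    exact (e.symm i).2.1.le_sup
  · intro r _ t _ _
    ext i
    exact le_inf_iff
end
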